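/- Let U ∈ C^{2k}(ℝⁿ \ {0}) satisfy Δᵏ U = 0 on ℝⁿ \ {0} (Laplacian with minus-sign convention), |U(X)| ≤ |X|^{-γ} for all X ≠ 0 with 0 < γ < n - 2k, and |∇ˡU(X)| ≤ Cₗ|X|^{-γ-l} for all X ≠ 0 and 1 ≤ l ≤ 2k. Then U ≡ 0 on ℝⁿ \ {0}. -/

import Mathlib

open MeasureTheory Real

/-- Partial derivative in the `i`-th coordinate direction on `ℝⁿ`. -/
noncomputable def pd {n : ℕ} (i : Fin n) (f : EuclideanSpace ℝ (Fin n) → ℝ) :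
    EuclideanSpace ℝ (Fin n) → ℝ :=
  fun x => fderiv ℝ f x (EuclideanSpace.single i 1)

/-- The Euclidean Laplacian with the minus-sign convention `Δu = -∑ᵢ ∂ᵢᵢ u`. -/
noncomputable def lap {n : ℕ} (f : EuclideanSpace ℝ (Fin n) → ℝ) :
    EuclideanSpace ℝ (Fin n) → ℝ :=
  fun x => -∑ i, pd i (pd i f) x

open Filter Topology


lemma pd_contDiffAt {n : ℕ} {i : Fin n} {f : (EuclideanSpace ℝ (Fin n)) → ℝ} {x : EuclideanSpace ℝ (Fin n)} {m : ℕ}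
    (hf : ContDiffAt ℝ ((m + 1 : ℕ) : WithTop ℕ∞) f x) :
    ContDiffAt ℝ (m : WithTop ℕ∞) (pd i f) x := by
  have h : ContDiffAt ℝ (m : WithTop ℕ∞) (fderiv ℝ f) x :=
    hf.fderiv_right (by push_cast; exact le_rfl)
  exact h.clm_apply contDiffAt_const

lemma pd_norm_le {n : ℕ} {i : Fin n} {f : (EuclideanSpace ℝ (Fin n)) → ℝ} {x : EuclideanSpace ℝ (Fin n)} {m : ℕ}
    (hf : ContDiffAt ℝ ((m + 1 : ℕ) : WithTop ℕ∞) f x) :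
    ‖iteratedFDeriv ℝ m (pd i f) x‖ ≤ ‖iteratedFDeriv ℝ (m + 1) f x‖ := by
  have h : ContDiffAt ℝ (m : WithTop ℕ∞) (fderiv ℝ f) x :=
    hf.fderiv_right (by push_cast; exact le_rfl)
  let L : ((EuclideanSpace ℝ (Fin n)) →L[ℝ] ℝ) →L[ℝ] ℝ :=
    ContinuousLinearMap.apply ℝ ℝ (EuclideanSpace.single i 1)
  have hL : ‖L‖ ≤ 1 := by
    refine ContinuousLinearMap.opNorm_le_bound _ zero_le_one fun A => ?_
    have := A.le_opNorm (EuclideanSpace.single i 1)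
    simpa [L] using this
  have e : pd i f = L ∘ fderiv ℝ f := by
    funext y; simp [pd, L]
  rw [e, ← norm_iteratedFDeriv_fderiv]
  refine (L.norm_iteratedFDeriv_comp_left h le_rfl).trans ?_
  nlinarith [norm_nonneg (iteratedFDeriv ℝ m (fderiv ℝ f) x)]

lemma lap_contDiffAt {n : ℕ} {f : (EuclideanSpace ℝ (Fin n)) → ℝ} {x : EuclideanSpace ℝ (Fin n)} {m : ℕ}
    (hf : ContDiffAt ℝ ((m + 2 : ℕ) : WithTop ℕ∞) f x) :
    ContDiffAt ℝ (m : WithTop ℕ∞) (lap f) x := by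
  unfold lap
  exact (ContDiffAt.sum fun i _ => pd_contDiffAt (pd_contDiffAt hf)).neg

lemma lap_norm_le {n : ℕ} {f : (EuclideanSpace ℝ (Fin n)) → ℝ} {x : EuclideanSpace ℝ (Fin n)} {m : ℕ}
    (hf : ContDiffAt ℝ ((m + 2 : ℕ) : WithTop ℕ∞) f x) :
    ‖iteratedFDeriv ℝ m (lap f) x‖ ≤ n * ‖iteratedFDeriv ℝ (m + 2) f x‖ := by
  have e : lap f = -(∑ i, pd i (pd i f)) := by
    funext y; simp [lap]
  rw [e, iteratedFDeriv_neg_apply, norm_neg]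
  have h2 : ∀ i : Fin n, ContDiffAt ℝ (m : WithTop ℕ∞) (pd i (pd i f)) x :=
    fun i => pd_contDiffAt (pd_contDiffAt hf)
  have : iteratedFDeriv ℝ m (∑ i, pd i (pd i f)) x
      = ∑ i, iteratedFDeriv ℝ m (pd i (pd i f)) x := by
    have := iteratedFDeriv_sum_apply (𝕜 := ℝ) (f := fun i => pd i (pd i f)) (u := Finset.univ)
      (n := m) (x := x) (fun i _ => h2 i)
    convert this using 2
  rw [this]
  refine (norm_sum_le _ _).trans ?_
  calc _ ≤ ∑ i : Fin n, ‖iteratedFDeriv ℝ (m + 2) f x‖ :=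
        Finset.sum_le_sum fun i _ => (pd_norm_le (pd_contDiffAt hf)).trans (pd_norm_le hf)
    _ = _ := by simp

lemma lap_iter {n : ℕ} {f : (EuclideanSpace ℝ (Fin n)) → ℝ} {x : EuclideanSpace ℝ (Fin n)} (j : ℕ) : ∀ {m : ℕ},
    ContDiffAt ℝ ((m + 2 * j : ℕ) : WithTop ℕ∞) f x →
    ContDiffAt ℝ (m : WithTop ℕ∞) (lap^[j] f) x ∧
    ‖iteratedFDeriv ℝ m (lap^[j] f) x‖ ≤ n ^ j * ‖iteratedFDeriv ℝ (m + 2 * j) f x‖ := by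
  induction j with
  | zero => intro m h; simpa using h
  | succ j ih =>
    intro m h
    have := ih (m := m + 2) (by convert h using 2; ring_nf)
    rw [Function.iterate_succ_apply']
    refine ⟨lap_contDiffAt this.1, (lap_norm_le this.1).trans ?_⟩
    rw [pow_succ', mul_assoc]
    have e : m + 2 + 2 * j = m + 2 * (j + 1) := by ring
    rw [e] at this
    exact mul_le_mul_of_nonneg_left this.2 (by positivity)

lemma second_deriv_nonpos {g : ℝ → ℝ} {t : ℝ} (hm : IsLocalMax g t) (hc : ContinuousAt g t) :
    deriv (deriv g) t ≤ 0 := by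
  by_contra h
  push Not at h
  have hmin : IsLocalMin g t := isLocalMin_of_deriv_deriv_pos h hm.deriv_eq_zero hc
  have e : g =ᶠ[𝓝 t] fun _ => g t := by
    filter_upwards [hm, hmin] with y h1 h2
    exact le_antisymm h1 h2
  have := e.deriv.deriv_eq
  simp at this
  linarith

lemma pd_pd_nonpos {n : ℕ} {i : Fin n} {f : (EuclideanSpace ℝ (Fin n)) → ℝ} {x : EuclideanSpace ℝ (Fin n)}
    (hf : ContDiffAt ℝ 2 f x) (hm : IsLocalMax f x) : pd i (pd i f) x ≤ 0 := by
  set e : EuclideanSpace ℝ (Fin n) := EuclideanSpace.single i 1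
  have hl : ∀ t : ℝ, HasDerivAt (fun t : ℝ => x + t • e) e t := fun t => by
    simpa using ((hasDerivAt_id t).smul_const e).const_add x
  have hc : ContinuousAt (fun t : ℝ => x + t • e) 0 := (hl 0).continuousAt
  have ht : Tendsto (fun t : ℝ => x + t • e) (𝓝 0) (𝓝 x) := by
    simpa [ContinuousAt] using hc
  have hd : ∀ᶠ y in 𝓝 x, DifferentiableAt ℝ f y := by
    filter_upwards [hf.eventually (by simp)] with y hy
    exact hy.differentiableAt (by simp)
  have hdp : DifferentiableAt ℝ (pd i f) x :=
    (pd_contDiffAt (m := 1) (by exact_mod_cast hf)).differentiableAt (by simp)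
  have h1 : deriv (fun t : ℝ => f (x + t • e)) =ᶠ[𝓝 0] fun t => pd i f (x + t • e) := by
    filter_upwards [ht.eventually hd] with t hy
    exact (hy.hasFDerivAt.comp_hasDerivAt t (hl t)).deriv
  have h2 : deriv (fun t : ℝ => pd i f (x + t • e)) 0 = pd i (pd i f) x := by
    have h3 : HasFDerivAt (pd i f) (fderiv ℝ (pd i f) x) (x + (0:ℝ) • e) := by
      simpa using hdp.hasFDerivAt
    exact (h3.comp_hasDerivAt (0:ℝ) (hl 0)).deriv
  rw [← h2, ← h1.deriv_eq]
  apply second_deriv_nonpos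
  · have := ht.eventually hm
    filter_upwards [this] with t h
    simpa using h
  · have : ContinuousAt f (x + (0:ℝ) • e) := by simpa using hf.continuousAt
    exact ContinuousAt.comp (f := fun t : ℝ => x + t • e) this hc

lemma pd_congr {n : ℕ} {i : Fin n} {f g : (EuclideanSpace ℝ (Fin n)) → ℝ} {x : EuclideanSpace ℝ (Fin n)} (h : f =ᶠ[𝓝 x] g) :
    pd i f x = pd i g x := by
  unfold pd; rw [h.fderiv_eq]

lemma pd_pd_sub {n : ℕ} {i : Fin n} {f g : (EuclideanSpace ℝ (Fin n)) → ℝ} {x : EuclideanSpace ℝ (Fin n)} (c : ℝ)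
    (hf : ContDiffAt ℝ 2 f x) (hg : ContDiffAt ℝ 2 g x) :
    pd i (pd i (fun y => f y + c * g y)) x = pd i (pd i f) x + c * pd i (pd i g) x := by
  have key : ∀ {f g : (EuclideanSpace ℝ (Fin n)) → ℝ} {x : EuclideanSpace ℝ (Fin n)}, DifferentiableAt ℝ f x → DifferentiableAt ℝ g x →
      pd i (fun y => f y + c * g y) x = pd i f x + c * pd i g x := by
    intro f g x hf hg
    have := (hf.hasFDerivAt.add (hg.hasFDerivAt.const_mul c)).fderiv
    have h2 : fderiv ℝ (fun y => f y + c * g y) x = fderiv ℝ f x + c • fderiv ℝ g x := this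
    simp [pd, h2]
  have e : pd i (fun y => f y + c * g y) =ᶠ[𝓝 x] fun y => pd i f y + c * pd i g y := by
    filter_upwards [hf.eventually (by simp), hg.eventually (by simp)] with y h1 h2
    exact key (h1.differentiableAt (by simp)) (h2.differentiableAt (by simp))
  rw [pd_congr e]
  exact key ((pd_contDiffAt (m := 1) (by exact_mod_cast hf)).differentiableAt (by simp))
    ((pd_contDiffAt (m := 1) (by exact_mod_cast hg)).differentiableAt (by simp))

lemma bar_pd {n : ℕ} {i : Fin n} {x : EuclideanSpace ℝ (Fin n)} (hx : x ≠ 0) (p : ℝ) :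
    HasFDerivAt (fun y : EuclideanSpace ℝ (Fin n) => (‖y‖ ^ 2) ^ p)
      ((p * (‖x‖ ^ 2) ^ (p - 1)) • (2 • innerSL ℝ x)) x := by
  have h0 : ‖x‖ ^ 2 ≠ 0 := by simpa using hx
  have h1 := (hasStrictFDerivAt_norm_sq x).hasFDerivAt
  exact (Real.hasDerivAt_rpow_const (p := p) (Or.inl h0)).comp_hasFDerivAt x h1

lemma bar_contDiffAt {n : ℕ} {x : EuclideanSpace ℝ (Fin n)} (hx : x ≠ 0) (p : ℝ) :
    ContDiffAt ℝ 2 (fun y : EuclideanSpace ℝ (Fin n) => (‖y‖ ^ 2) ^ p) x := by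
  have h0 : ‖x‖ ^ 2 ≠ 0 := by simpa using hx
  exact (contDiff_norm_sq ℝ).contDiffAt.rpow_const_of_ne h0

lemma bar_pd_pd {n : ℕ} {i : Fin n} {x : EuclideanSpace ℝ (Fin n)} (hx : x ≠ 0) (p : ℝ) :
    pd i (pd i (fun y : EuclideanSpace ℝ (Fin n) => (‖y‖ ^ 2) ^ p)) x =
      2 * p * (‖x‖ ^ 2) ^ (p - 1) + 4 * p * (p - 1) * (‖x‖ ^ 2) ^ (p - 2) * (x i) ^ 2 := by
  have e : pd i (fun y : EuclideanSpace ℝ (Fin n) => (‖y‖ ^ 2) ^ p) =ᶠ[𝓝 x]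
      fun y => (2 * p) * ((‖y‖ ^ 2) ^ (p - 1) * y i) := by
    filter_upwards [isOpen_ne.mem_nhds hx] with y hy
    unfold pd
    rw [(bar_pd (i := i) hy p).fderiv]
    simp [EuclideanSpace.inner_single_right]
    ring
  rw [pd_congr e]
  have hi : HasFDerivAt (fun y : EuclideanSpace ℝ (Fin n) => y i) (EuclideanSpace.proj i : (EuclideanSpace ℝ (Fin n)) →L[ℝ] ℝ) x :=
    (EuclideanSpace.proj i : (EuclideanSpace ℝ (Fin n)) →L[ℝ] ℝ).hasFDerivAt
  have h := (((bar_pd (i := i) hx (p - 1)).mul hi).const_mul (2 * p)).fderiv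
  unfold pd
  have h' : fderiv ℝ (fun y : EuclideanSpace ℝ (Fin n) => (2 * p) * ((‖y‖ ^ 2) ^ (p - 1) * y i)) x = _ := h
  rw [h']
  simp [EuclideanSpace.inner_single_right]
  rw [show p - 1 - 1 = p - 2 by ring]
  ring

lemma bar_sum {n : ℕ} {x : EuclideanSpace ℝ (Fin n)} (hx : x ≠ 0) (p : ℝ) :
    ∑ i, pd i (pd i (fun y : EuclideanSpace ℝ (Fin n) => (‖y‖ ^ 2) ^ p)) x =
      2 * p * (n + 2 * p - 2) * (‖x‖ ^ 2) ^ (p - 1) := by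
  have h0 : ‖x‖ ^ 2 ≠ 0 := by simpa using hx
  simp_rw [bar_pd_pd hx p]
  rw [Finset.sum_add_distrib, ← Finset.mul_sum, ← Finset.mul_sum, ← EuclideanSpace.real_norm_sq_eq]
  have : (‖x‖ ^ 2) ^ (p - 1) = (‖x‖ ^ 2) ^ (p - 2) * ‖x‖ ^ 2 := by
    rw [← Real.rpow_add_one h0]; ring_nf
  rw [this]
  simp
  ring

lemma norm_bar {n : ℕ} (x : EuclideanSpace ℝ (Fin n)) (a : ℝ) : (‖x‖ ^ 2) ^ (-a / 2) = ‖x‖ ^ (-a) := by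
  rw [← Real.rpow_natCast, ← Real.rpow_mul (norm_nonneg _)]
  congr 1
  push_cast; ring

lemma harm_le {n : ℕ} {β : ℝ} (h0 : 0 < β) (h1 : β < n - 2) {C : ℝ} {V : (EuclideanSpace ℝ (Fin n)) → ℝ}
    (hV : ∀ x, x ≠ 0 → ContDiffAt ℝ 2 V x)
    (hl : ∀ x, x ≠ 0 → ∑ i, pd i (pd i V) x = 0)
    (hb : ∀ x, x ≠ 0 → V x ≤ C * ‖x‖ ^ (-β)) (y : EuclideanSpace ℝ (Fin n)) (hy : y ≠ 0)
    {ε : ℝ} (hε : 0 < ε) :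
    V y ≤ ε * (‖y‖ ^ (-((β + (n - 2)) / 2)) + ‖y‖ ^ (-(β / 2))) := by
  set a := (β + (n - 2)) / 2 with ha
  set b := β / 2 with hbd
  by_contra hcon
  push Not at hcon
  have hz : ∀ᶠ t in 𝓝[>] (0:ℝ), C * t ^ (-β) ≤ ε * t ^ (-a) := by
    have ht : Tendsto (fun t : ℝ => C * t ^ (a - β)) (𝓝[>] 0) (𝓝 0) := by
      have hc : ContinuousAt (fun t : ℝ => C * t ^ (a - β)) 0 :=
        (Real.continuousAt_rpow_const _ _ (Or.inr (by linarith))).const_mul C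
      have := hc.tendsto
      simp only [Real.zero_rpow (show a - β ≠ 0 by linarith), mul_zero] at this
      exact this.mono_left nhdsWithin_le_nhds
    filter_upwards [ht.eventually (gt_mem_nhds hε), self_mem_nhdsWithin] with t h1 h2
    have h2 : 0 < t := h2
    have : t ^ (-β) = t ^ (a - β) * t ^ (-a) := by
      rw [← Real.rpow_add h2]; ring_nf
    rw [this, ← mul_assoc]
    exact mul_le_mul_of_nonneg_right h1.le (by positivity)
  have hi : ∀ᶠ t in atTop, C * t ^ (-β) ≤ ε * t ^ (-b) := by
    have ht : Tendsto (fun t : ℝ => C * t ^ (-b)) atTop (𝓝 0) := by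
      simpa using (tendsto_rpow_neg_atTop (show 0 < b by linarith)).const_mul C
    filter_upwards [ht.eventually (gt_mem_nhds hε), eventually_gt_atTop 0] with t h1 h2
    have : t ^ (-β) = t ^ (-b) * t ^ (-b) := by
      rw [← Real.rpow_add h2]; congr 1; linarith
    rw [this, ← mul_assoc]
    exact mul_le_mul_of_nonneg_right h1.le (by positivity)
  obtain ⟨r, hr0, hr⟩ := mem_nhdsGT_iff_exists_Ioc_subset.1 hz
  obtain ⟨R, hR⟩ := eventually_atTop.1 hi
  have hr0 : 0 < r := hr0
  set w : (EuclideanSpace ℝ (Fin n)) → ℝ := fun x => V x +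
    (-ε) * ((‖x‖ ^ 2) ^ (-a / 2) + 1 * (‖x‖ ^ 2) ^ (-b / 2)) with hw
  have hwn : ∀ x, w x = V x - ε * (‖x‖ ^ (-a) + ‖x‖ ^ (-b)) := fun x => by
    simp only [hw, norm_bar]; ring
  have hpos : ∀ x, x ≠ 0 → 0 < w x → r < ‖x‖ ∧ ‖x‖ < R := by
    intro x hx hx0
    have hnx : 0 < ‖x‖ := norm_pos_iff.2 hx
    rw [hwn] at hx0
    have hbx := hb x hx
    have p1 : 0 < ε * ‖x‖ ^ (-a) := by positivity
    have p2 : 0 < ε * ‖x‖ ^ (-b) := by positivity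
    constructor
    · by_contra! h
      have : C * ‖x‖ ^ (-β) ≤ ε * ‖x‖ ^ (-a) := hr ⟨hnx, h⟩
      linarith
    · by_contra! h
      have := hR _ h
      linarith
  have hbc : ∀ x : EuclideanSpace ℝ (Fin n), x ≠ 0 → ContDiffAt ℝ 2
      (fun x : EuclideanSpace ℝ (Fin n) => (‖x‖ ^ 2) ^ (-a / 2) + 1 * (‖x‖ ^ 2) ^ (-b / 2)) x := fun x hx =>
    (bar_contDiffAt hx _).add (contDiffAt_const.mul (bar_contDiffAt hx _))
  have hwc : ∀ x, x ≠ 0 → ContDiffAt ℝ 2 w x := fun x hx =>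
    (hV x hx).add (contDiffAt_const.mul (hbc x hx))
  have hwy : 0 < w y := by rw [hwn]; linarith
  set K : Set (EuclideanSpace ℝ (Fin n)) := Metric.closedBall 0 R ∩ {x | r ≤ ‖x‖}
  have hK : IsCompact K :=
    (isCompact_closedBall _ _).inter_right (isClosed_le continuous_const continuous_norm)
  have hK0 : ∀ x ∈ K, x ≠ 0 := by
    rintro x ⟨_, hx⟩ rfl
    simp at hx; linarith
  have hyK : y ∈ K := by
    have := hpos y hy hwy
    exact ⟨by simpa using this.2.le, this.1.le⟩
  obtain ⟨x, hxK, hmax⟩ := hK.exists_isMaxOn ⟨y, hyK⟩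
    (fun x hx => (hwc x (hK0 x hx)).continuousAt.continuousWithinAt)
  have hx := hK0 x hxK
  have hwx : 0 < w x := hwy.trans_le (hmax hyK)
  have hxx := hpos x hx hwx
  have hloc : IsLocalMax w x := by
    refine hmax.isLocalMax ?_
    filter_upwards [continuous_norm.continuousAt.eventually (lt_mem_nhds hxx.1),
      continuous_norm.continuousAt.eventually (gt_mem_nhds hxx.2)] with z h1 h2
    exact ⟨by simpa using h2.le, h1.le⟩
  have hs : ∑ i, pd i (pd i w) x ≤ 0 :=
    Finset.sum_nonpos fun i _ => pd_pd_nonpos (hwc x hx) hloc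
  have he : ∀ i, pd i (pd i w) x = pd i (pd i V) x + (-ε) *
      (pd i (pd i (fun x : EuclideanSpace ℝ (Fin n) => (‖x‖ ^ 2) ^ (-a / 2))) x +
        1 * pd i (pd i (fun x : EuclideanSpace ℝ (Fin n) => (‖x‖ ^ 2) ^ (-b / 2))) x) := fun i => by
    rw [hw, pd_pd_sub _ (hV x hx) (hbc x hx),
      pd_pd_sub _ (bar_contDiffAt hx _) (bar_contDiffAt hx _)]
  simp_rw [he, one_mul] at hs
  rw [Finset.sum_add_distrib, hl x hx, ← Finset.mul_sum, Finset.sum_add_distrib,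
    bar_sum hx, bar_sum hx] at hs
  have hq : 0 < ‖x‖ ^ 2 := by have := norm_pos_iff.2 hx; positivity
  have q1 : 0 < (‖x‖ ^ 2) ^ (-a / 2 - 1) := by positivity
  have q2 : 0 < (‖x‖ ^ 2) ^ (-b / 2 - 1) := by positivity
  have c1 : 0 < a * (n - 2 - a) := mul_pos (by linarith) (by linarith)
  have c2 : 0 < b * (n - 2 - b) := mul_pos (by linarith) (by linarith)
  have t1 := mul_pos hε (mul_pos c1 q1)
  have t2 := mul_pos hε (mul_pos c2 q2)
  nlinarith

lemma harm_nonpos {n : ℕ} {β : ℝ} (h0 : 0 < β) (h1 : β < n - 2) {C : ℝ} {V : (EuclideanSpace ℝ (Fin n)) → ℝ}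
    (hV : ∀ x, x ≠ 0 → ContDiffAt ℝ 2 V x)
    (hl : ∀ x, x ≠ 0 → ∑ i, pd i (pd i V) x = 0)
    (hb : ∀ x, x ≠ 0 → V x ≤ C * ‖x‖ ^ (-β)) (y : EuclideanSpace ℝ (Fin n)) (hy : y ≠ 0) : V y ≤ 0 := by
  have hny : 0 < ‖y‖ := norm_pos_iff.2 hy
  set M := ‖y‖ ^ (-((β + (n - 2)) / 2)) + ‖y‖ ^ (-(β / 2)) with hM
  have hMp : 0 < M := by positivity
  refine le_of_forall_pos_le_add fun δ hδ => ?_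
  have := harm_le h0 h1 hV hl hb y hy (div_pos hδ hMp)
  rw [← hM, div_mul_cancel₀ _ hMp.ne'] at this
  linarith

lemma harm_zero {n : ℕ} {β : ℝ} (h0 : 0 < β) (h1 : β < n - 2) {C : ℝ} {V : (EuclideanSpace ℝ (Fin n)) → ℝ}
    (hV : ∀ x, x ≠ 0 → ContDiffAt ℝ 2 V x)
    (hl : ∀ x, x ≠ 0 → lap V x = 0)
    (hb : ∀ x, x ≠ 0 → |V x| ≤ C * ‖x‖ ^ (-β)) (y : EuclideanSpace ℝ (Fin n)) (hy : y ≠ 0) : V y = 0 := by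
  have hl' : ∀ x, x ≠ 0 → ∑ i, pd i (pd i V) x = 0 := fun x hx => by
    have := hl x hx
    simpa [lap] using this
  have e : ∀ i : Fin n, pd i (pd i (fun x => -V x)) = fun x => - pd i (pd i V) x := by
    intro i
    have e1 : ∀ f : (EuclideanSpace ℝ (Fin n)) → ℝ, pd i (fun x => -f x) = fun x => - pd i f x := by
      intro f; funext x; simp [pd, fderiv_fun_neg]
    rw [e1, e1]
  apply le_antisymm
  · exact harm_nonpos h0 h1 hV hl' (fun x hx => (le_abs_self _).trans (hb x hx)) y hy
  · have := harm_nonpos h0 h1 (V := fun x => -V x) (fun x hx => (hV x hx).neg)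
      (fun x hx => by simp [e, hl' x hx])
      (fun x hx => (neg_le_abs _).trans (hb x hx)) y hy
    linarith

/-- Liouville theorem for punctured polyharmonic functions with subcritical decay:
if `U ∈ C^{2k}(ℝⁿ \ {0})` satisfies `Δᵏ U = 0` on `ℝⁿ \ {0}`, `|U(X)| ≤ |X|^{-γ}` for
some `0 < γ < n - 2k`, and `|∇ˡU(X)| ≤ Cₗ |X|^{-γ-l}` for `1 ≤ l ≤ 2k`, then
`U ≡ 0` on `ℝⁿ \ {0}`. -/
theorem liouville_punctured_polyharmonic {n k : ℕ} (hk : 2 ≤ 2 * k) (hkn : 2 * k < n)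
    (γ : ℝ) (hγ0 : 0 < γ) (hγ1 : γ < (n : ℝ) - 2 * k)
    (U : EuclideanSpace ℝ (Fin n) → ℝ)
    (hreg : ContDiffOn ℝ (2 * k : ℕ) U {(0 : EuclideanSpace ℝ (Fin n))}ᶜ)
    (hharm : ∀ x : EuclideanSpace ℝ (Fin n), x ≠ 0 → (lap^[k] U) x = 0)
    (hU : ∀ x : EuclideanSpace ℝ (Fin n), x ≠ 0 → |U x| ≤ ‖x‖ ^ (-γ))
    (hD : ∀ l : ℕ, 1 ≤ l → l ≤ 2 * k → ∃ C : ℝ,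
      ∀ x : EuclideanSpace ℝ (Fin n), x ≠ 0 →
        ‖iteratedFDeriv ℝ l U x‖ ≤ C * ‖x‖ ^ (-γ - l)) :
    ∀ x : EuclideanSpace ℝ (Fin n), x ≠ 0 → U x = 0 := by
  have hC : ∀ x : EuclideanSpace ℝ (Fin n), x ≠ 0 → ContDiffAt ℝ (2 * k : ℕ) U x :=
    fun x hx => hreg.contDiffAt (isOpen_compl_singleton.mem_nhds hx)
  have key : ∀ m : ℕ, m ≤ k → ∀ x : EuclideanSpace ℝ (Fin n), x ≠ 0 →
      (lap^[k - m] U) x = 0 := by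
    intro m
    induction m with
    | zero => intro _; simpa using hharm
    | succ m ih =>
      intro hm
      obtain ⟨j, hj⟩ : ∃ j, k = j + (m + 1) := ⟨k - (m + 1), by omega⟩
      have e1 : k - (m + 1) = j := by omega
      have e2 : k - m = j + 1 := by omega
      have ih' := ih (by omega)
      rw [e2, Function.iterate_succ_apply'] at ih'
      rw [e1]
      obtain ⟨C, hCb⟩ : ∃ C : ℝ, ∀ x : EuclideanSpace ℝ (Fin n), x ≠ 0 →
          ‖iteratedFDeriv ℝ (2 * j) U x‖ ≤ C * ‖x‖ ^ (-(γ + 2 * j)) := by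
        rcases Nat.eq_zero_or_pos j with rfl | hjp
        · refine ⟨1, fun x hx => ?_⟩
          simpa using hU x hx
        · obtain ⟨C, h⟩ := hD (2 * j) (by omega) (by omega)
          refine ⟨C, fun x hx => (h x hx).trans_eq ?_⟩
          congr 2; push_cast; ring
      have hjk : (j : ℝ) + 1 ≤ k := by exact_mod_cast (by omega : j + 1 ≤ k)
      refine harm_zero (β := γ + 2 * j) (C := n ^ j * C) (by positivity) (by linarith)
        (fun x hx => ?_) ih' (fun x hx => ?_)
      · exact_mod_cast (lap_iter j (m := 2)
          ((hC x hx).of_le (by exact_mod_cast (by omega : 2 + 2 * j ≤ 2 * k)))).1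
      · have := (lap_iter j (m := 0)
          ((hC x hx).of_le (by exact_mod_cast (by omega : 0 + 2 * j ≤ 2 * k)))).2
        rw [norm_iteratedFDeriv_zero, Real.norm_eq_abs, Nat.zero_add] at this
        rw [mul_assoc]
        exact this.trans (mul_le_mul_of_nonneg_left (hCb x hx) (by positivity))
  simpa using key k le_rfl
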